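/- Let x ∈ 𝒟 satisfy E_f(x) < 1/(a + b), where a = (n−1)^{1/q} and b = 2^{1/q}. Then ‖W_f(Φ(x))‖ ⪯ β(E_f(x))·‖W_f(x)‖ coordinatewise, where β(t) = (a t² / ((1 − a t)(1 − (a+1)t))) · (1 + a t/((n−1)(1 − (a+b)t)))^{n−1}. (Lemma 3.3) -/

import Mathlib

open Finset Polynomial Filter

noncomputable section

/-- The Weierstrass correction `W_i(x) = f(x_i)/(C₀ ∏_{j≠i}(x_i − x_j))`. -/
def Wc {n : ℕ} {K : Type*} [NormedField K] (f : Polynomial K) (x : Fin n → K) (i : Fin n) : K :=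
  eval (x i) f / (f.leadingCoeff * ∏ j ∈ univ.erase i, (x i - x j))

/-- `dmin x i = min_{j ≠ i} ‖x i - x j‖`. -/
def dmin {n : ℕ} {K : Type*} [NormedField K] (x : Fin n → K) (i : Fin n) : ℝ :=
  if h : (univ.erase i).Nonempty then (univ.erase i).inf' h fun j => ‖x i - x j‖ else 0

/-- `E_f(x)` : the ℓ^p norm of the vector `(‖W_i(x)‖ / d_i(x))_i`. -/
def Ef {n : ℕ} {K : Type*} [NormedField K] (p : ENNReal) (f : Polynomial K)
    (x : Fin n → K) : ℝ :=
  ‖(WithLp.equiv p (Fin n → ℝ)).symm (fun i => ‖Wc f x i‖ / dmin x i)‖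

/-- `σ_i(x) = Σ_{j≠i} W_j(x)/(x_i − x_j)`. -/
def sigmaf {n : ℕ} {K : Type*} [NormedField K] (f : Polynomial K) (x : Fin n → K)
    (i : Fin n) : K :=
  ∑ j ∈ univ.erase i, Wc f x j / (x i - x j)

/-- The Ehrlich iteration function. -/
def PhiE {n : ℕ} {K : Type*} [NormedField K] (f : Polynomial K) (x : Fin n → K) : Fin n → K :=
  fun i => x i - Wc f x i / (1 + sigmaf f x i)

/-- The Prešić–Tanabe iteration function. -/
def TnbE {n : ℕ} {K : Type*} [NormedField K] (f : Polynomial K) (x : Fin n → K) : Fin n → K :=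
  fun i => x i - Wc f x i * (1 - sigmaf f x i)

/-- `ξ` is a root vector of `f`, i.e. `f(z) = C₀ ∏ (z − ξᵢ)`. -/
def IsRootVector {n : ℕ} {K : Type*} [NormedField K] (f : Polynomial K) (ξ : Fin n → K) : Prop :=
  f = C f.leadingCoeff * ∏ i, (X - C (ξ i))

/-- `E_f(x)` in the case `p = ∞`: the max of `‖W_i(x)‖ / d_i(x)`. -/
def Einf {n : ℕ} {K : Type*} [NormedField K] (f : Polynomial K) (x : Fin n → K) : ℝ :=
  if h : (univ : Finset (Fin n)).Nonempty then univ.sup' h fun i => ‖Wc f x i‖ / dmin x i else 0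

theorem sum_le_card_rpow_mul_lp_norm {ι : Type*} [Fintype ι] {p q : ENNReal} (hp : 1 ≤ p)
    (hpq : p⁻¹ + q⁻¹ = 1) (u : ι → ℝ) (hu : ∀ i, 0 ≤ u i) (s : Finset ι) :
    ∑ j ∈ s, u j ≤
      (#s : ℝ) ^ (ENNReal.toReal q⁻¹) * ‖(WithLp.equiv p (ι → ℝ)).symm u‖ := by
  by_cases hpt : p = ⊤
  · subst hpt
    have hq : q⁻¹ = 1 := by simpa using hpq
    rw [hq, ENNReal.toReal_one, Real.rpow_one, PiLp.norm_eq_ciSup, ← nsmul_eq_mul]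
    refine sum_le_card_nsmul _ _ _ fun j _ => ?_
    refine (Real.le_norm_self (u j)).trans ?_
    exact le_ciSup (f := fun i => ‖u i‖) (Set.finite_range _).bddAbove j
  · have hP : 1 ≤ p.toReal := by
      simpa using (ENNReal.toReal_le_toReal ENNReal.one_ne_top hpt).2 hp
    have hP0 : 0 < p.toReal := by linarith
    have hqt : q⁻¹ ≠ ⊤ := fun h => by simp [h] at hpq
    have hpt' : p⁻¹ ≠ ⊤ := fun h => by simp [h] at hpq
    have hr : p.toReal⁻¹ + (q⁻¹).toReal = 1 := by
      rw [← ENNReal.toReal_inv, ← ENNReal.toReal_add hpt' hqt, hpq, ENNReal.toReal_one]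
    have hr' : (q⁻¹).toReal = (p.toReal - 1) * (1 / p.toReal) := by
      have : (q⁻¹).toReal = 1 - p.toReal⁻¹ := by linarith
      rw [this]; field_simp
    have hs : 0 ≤ ∑ j ∈ s, u j := sum_nonneg fun j _ => hu j
    have hall : 0 ≤ ∑ j, u j ^ p.toReal := sum_nonneg fun j _ => Real.rpow_nonneg (hu j) _
    have key : (∑ j ∈ s, u j) ^ p.toReal ≤
        (#s : ℝ) ^ (p.toReal - 1) * ∑ j, u j ^ p.toReal := by
      have h1 := Real.rpow_sum_le_const_mul_sum_rpow s u hP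
      simp only [abs_of_nonneg (hu _)] at h1
      refine h1.trans (mul_le_mul_of_nonneg_left ?_ (by positivity))
      exact sum_le_sum_of_subset_of_nonneg (subset_univ s)
        fun j _ _ => Real.rpow_nonneg (hu j) _
    have hnorm : ‖(WithLp.equiv p (ι → ℝ)).symm u‖ =
        (∑ j, u j ^ p.toReal) ^ (1 / p.toReal) := by
      rw [PiLp.norm_eq_sum hP0]
      simp [abs_of_nonneg (hu _)]
    have h2 := Real.rpow_le_rpow (by positivity) key (z := 1 / p.toReal) (by positivity)
    rw [← Real.rpow_mul hs, mul_one_div_cancel hP0.ne', Real.rpow_one,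
      Real.mul_rpow (by positivity) hall, ← Real.rpow_mul (by positivity)] at h2
    rwa [hnorm, hr']

theorem dmin_le_norm_sub {n : ℕ} {K : Type*} [NormedField K] (x : Fin n → K) {i j : Fin n}
    (hij : j ≠ i) : dmin x i ≤ ‖x i - x j‖ := by
  have hj : j ∈ univ.erase i := by simp [hij]
  rw [dmin, dif_pos ⟨j, hj⟩]
  exact inf'_le _ hj

theorem dmin_pos {n : ℕ} {K : Type*} [NormedField K] (hn : 2 ≤ n) {x : Fin n → K}
    (hx : Function.Injective x) (i : Fin n) : 0 < dmin x i := by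
  have hne : (univ.erase i).Nonempty := by
    rw [← card_pos, card_erase_of_mem (mem_univ i), card_univ, Fintype.card_fin]
    omega
  rw [dmin, dif_pos hne, lt_inf'_iff]
  intro j hj
  exact norm_pos_iff.2 (sub_ne_zero.2 (hx.ne (ne_of_mem_erase hj).symm))

theorem eval_eq_nodal_mul_one_add_sum_Wc {n : ℕ} {K : Type*} [NormedField K]
    {f : Polynomial K} (hdeg : f.degree = (n : ℕ)) {x : Fin n → K} (hx : Function.Injective x)
    {z : K} (hz : ∀ j, z ≠ x j) :
    eval z f = f.leadingCoeff * (∏ j, (z - x j)) * (1 + ∑ j, Wc f x j / (z - x j)) := by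
  have hf : f ≠ 0 := by rintro rfl; simp at hdeg
  have hlc : f.leadingCoeff ≠ 0 := leadingCoeff_ne_zero.2 hf
  have hN : (C f.leadingCoeff * Lagrange.nodal univ x).degree = n := by
    rw [degree_mul, degree_C hlc, Lagrange.degree_nodal, zero_add, card_univ, Fintype.card_fin]
  have hlt : (f - C f.leadingCoeff * Lagrange.nodal univ x).degree < #(univ : Finset (Fin n)) := by
    rw [card_univ, Fintype.card_fin, ← hdeg]
    refine degree_sub_lt_left (hdeg.trans hN.symm) hf ?_
    rw [leadingCoeff_mul, leadingCoeff_C, (Lagrange.nodal_monic).leadingCoeff, mul_one]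
  have h := congrArg (eval z) (Lagrange.eq_interpolate hx.injOn hlt)
  rw [Lagrange.eval_interpolate_not_at_node _ fun j _ => hz j] at h
  simp only [eval_sub, eval_mul, eval_C, Lagrange.eval_nodal_at_node (mem_univ _), mul_zero,
    sub_zero, Lagrange.eval_nodal] at h
  rw [sub_eq_iff_eq_add.1 h, mul_add, mul_one, add_comm]
  congr 1
  rw [mul_assoc, mul_left_comm]
  congr 1
  rw [mul_sum]
  refine sum_congr rfl fun j _ => ?_
  rw [Wc, Lagrange.nodalWeight, prod_inv_distrib]
  field_simp

theorem prod_one_add_le_one_add_div_pow {ι : Type*} (s : Finset ι) (hs : s.Nonempty)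
    (v : ι → ℝ) (hv : ∀ i ∈ s, 0 ≤ v i) {T : ℝ} (hT : ∑ i ∈ s, v i ≤ T) :
    ∏ i ∈ s, (1 + v i) ≤ (1 + T / #s) ^ #s := by
  have hc : (0 : ℝ) < #s := by exact_mod_cast hs.card_pos
  have h := Real.geom_mean_le_arith_mean s (fun _ => 1) (fun i => 1 + v i)
    (fun _ _ => zero_le_one) (by simpa using hs.card_pos)
    fun i hi => by linarith [hv i hi]
  simp only [Real.rpow_one, sum_const, nsmul_eq_mul, mul_one, one_mul, sum_add_distrib] at h
  have hprod : 0 ≤ ∏ i ∈ s, (1 + v i) := prod_nonneg fun i hi => by linarith [hv i hi]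
  have h1 := pow_le_pow_left₀ (Real.rpow_nonneg hprod _) h #s
  rw [Real.rpow_inv_natCast_pow hprod hs.card_pos.ne'] at h1
  refine h1.trans (pow_le_pow_left₀ (div_nonneg ?_ hc.le) ?_ _)
  · have := sum_nonneg hv
    linarith
  · rw [add_div, div_self hc.ne']
    gcongr

theorem Wc_PhiE_eq {n : ℕ} {K : Type*} [NormedField K]
    {f : Polynomial K} (hdeg : f.degree = (n : ℕ)) {x : Fin n → K} (hx : Function.Injective x)
    {i : Fin n} (hσ : 1 + sigmaf f x i ≠ 0) (hW : Wc f x i ≠ 0)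
    (hne : ∀ j, j ≠ i → PhiE f x i ≠ x j) :
    Wc f (PhiE f x) i = (PhiE f x i - x i) *
      (∑ j ∈ univ.erase i,
        Wc f x j * (x i - PhiE f x i) / ((PhiE f x i - x j) * (x i - x j))) *
      ∏ j ∈ univ.erase i, ((PhiE f x i - x j) / (PhiE f x i - PhiE f x j)) := by
  have hf : f ≠ 0 := by rintro rfl; simp at hdeg
  have hlc : f.leadingCoeff ≠ 0 := leadingCoeff_ne_zero.2 hf
  have hstep : PhiE f x i - x i = -(Wc f x i / (1 + sigmaf f x i)) := by
    simp only [PhiE]; ring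
  have hstep0 : PhiE f x i - x i ≠ 0 := by
    rw [hstep]; exact neg_ne_zero.2 (div_ne_zero hW hσ)
  have hz : ∀ j, PhiE f x i ≠ x j := by
    intro j
    by_cases hj : j = i
    · subst hj; exact sub_ne_zero.1 hstep0
    · exact hne j hj
  have hi : Wc f x i / (PhiE f x i - x i) = -(1 + sigmaf f x i) := by
    rw [hstep]; field_simp
  have hsum : 1 + ∑ j, Wc f x j / (PhiE f x i - x j) = ∑ j ∈ univ.erase i,
      Wc f x j * (x i - PhiE f x i) / ((PhiE f x i - x j) * (x i - x j)) := by
    rw [← add_sum_erase _ _ (mem_univ i), hi, sigmaf, neg_add, add_assoc,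
      add_neg_cancel_left, neg_add_eq_sub, ← sum_sub_distrib]
    refine sum_congr rfl fun j hj => ?_
    have h1 : PhiE f x i - x j ≠ 0 := sub_ne_zero.2 (hz j)
    have h2 : x i - x j ≠ 0 := sub_ne_zero.2 (hx.ne (ne_of_mem_erase hj).symm)
    field_simp
    ring
  rw [Wc, eval_eq_nodal_mul_one_add_sum_Wc hdeg hx hz, hsum,
    ← mul_prod_erase _ _ (mem_univ i), prod_div_distrib, mul_assoc, mul_div_mul_left _ _ hlc]
  ring

/-- Proinov, Lemma 3.3. -/
theorem stmt_11 {n : ℕ} {K : Type*} [NormedField K] [CompleteSpace K] (hn : 2 ≤ n)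
    (f : Polynomial K) (hdeg : f.degree = (n : ℕ))
    (p q : ENNReal) (hp : 1 ≤ p) (hpq : p⁻¹ + q⁻¹ = 1)
    (a b : ℝ) (ha : a = ((n : ℝ) - 1) ^ (ENNReal.toReal q⁻¹))
    (hb : b = (2 : ℝ) ^ (ENNReal.toReal q⁻¹))
    (β : ℝ → ℝ)
    (hβ : ∀ t, β t = a * t ^ 2 / ((1 - a * t) * (1 - (a + 1) * t)) *
      (1 + a * t / (((n : ℝ) - 1) * (1 - (a + b) * t))) ^ (n - 1))
    (x : Fin n → K) (hx : Function.Injective x)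
    (hE : Ef p f x < 1 / (a + b)) :
    ∀ i : Fin n, ‖Wc f (PhiE f x) i‖ ≤ β (Ef p f x) * ‖Wc f x i‖ := by
  intro i
  set E := Ef p f x with hEdef
  set u : Fin n → ℝ := fun i => ‖Wc f x i‖ / dmin x i with hu
  have hn1 : (1 : ℝ) ≤ (n : ℝ) - 1 := by
    have : (2 : ℝ) ≤ n := by exact_mod_cast hn
    linarith
  have ha1 : 1 ≤ a := ha ▸ Real.one_le_rpow hn1 ENNReal.toReal_nonneg
  have hb1 : 1 ≤ b := hb ▸ Real.one_le_rpow one_le_two ENNReal.toReal_nonneg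
  have hu0 : ∀ j, 0 ≤ u j := fun j => div_nonneg (norm_nonneg _) (dmin_pos hn hx j).le
  have holder : ∀ s : Finset (Fin n), ∑ j ∈ s, u j ≤ (#s : ℝ) ^ (ENNReal.toReal q⁻¹) * E :=
    sum_le_card_rpow_mul_lp_norm hp hpq u hu0
  have hcard : ∀ j : Fin n, #(univ.erase j) = n - 1 := fun j => by
    rw [card_erase_of_mem (mem_univ j), card_univ, Fintype.card_fin]
  have hcast : ((n - 1 : ℕ) : ℝ) = (n : ℝ) - 1 := by
    rw [Nat.cast_sub (by omega), Nat.cast_one]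
  have hsumE : ∀ j, ∑ k ∈ univ.erase j, u k ≤ a * E := fun j => by
    simpa only [hcard, hcast, ← ha] using holder (univ.erase j)
  have huE : ∀ j, u j ≤ E := fun j => by simpa using holder {j}
  have hpairE : ∀ j k, j ≠ k → u j + u k ≤ b * E := fun j k hjk => by
    simpa only [sum_pair hjk, card_pair hjk, Nat.cast_ofNat, ← hb] using holder {j, k}
  have hE0 : 0 ≤ E := (hu0 i).trans (huE i)
  have hab : (a + b) * E < 1 := by
    rw [lt_div_iff₀ (by linarith)] at hE; linarith
  have hA : 0 < 1 - a * E := by nlinarith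
  have hB : 0 < 1 - (a + 1) * E := by nlinarith
  have hD : 0 < 1 - (a + b) * E := by linarith
  have hx0 : ∀ {j k}, k ≠ j → 0 < ‖x j - x k‖ := fun h =>
    norm_pos_iff.2 (sub_ne_zero.2 (hx.ne h.symm))
  have hWu : ∀ {j k}, k ≠ j → ‖Wc f x j‖ ≤ u j * ‖x j - x k‖ := fun {j k} h => by
    calc ‖Wc f x j‖ = u j * dmin x j := (div_mul_cancel₀ _ (dmin_pos hn hx j).ne').symm
      _ ≤ _ := mul_le_mul_of_nonneg_left (dmin_le_norm_sub x h) (hu0 j)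
  have hWu' : ∀ {j k}, k ≠ j → ‖Wc f x k‖ ≤ u k * ‖x j - x k‖ := fun h => by
    rw [norm_sub_rev]; exact hWu h.symm
  have hσ : ∀ j, 1 - a * E ≤ ‖1 + sigmaf f x j‖ := fun j => by
    have h1 : ‖sigmaf f x j‖ ≤ a * E := by
      refine (norm_sum_le _ _).trans ((sum_le_sum fun k hk => ?_).trans (hsumE j))
      rw [norm_div, div_le_iff₀ (hx0 (ne_of_mem_erase hk))]
      exact hWu' (ne_of_mem_erase hk)
    have h2 := norm_sub_norm_le (1 : K) (-sigmaf f x j)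
    rw [sub_neg_eq_add, norm_neg, norm_one] at h2
    linarith
  have hstep : ∀ j, ‖PhiE f x j - x j‖ ≤ ‖Wc f x j‖ / (1 - a * E) := fun j => by
    have : PhiE f x j - x j = -(Wc f x j / (1 + sigmaf f x j)) := by simp only [PhiE]; ring
    rw [this, norm_neg, norm_div]
    exact div_le_div_of_nonneg_left (norm_nonneg _) hA (hσ j)
  have hstep' : ∀ {j k}, k ≠ j → ‖PhiE f x j - x j‖ ≤ u j / (1 - a * E) * ‖x j - x k‖ :=
    fun {j k} h => (hstep j).trans (by
      rw [div_mul_eq_mul_div]; exact div_le_div_of_nonneg_right (hWu h) hA.le)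
  have hsep : ∀ j ∈ univ.erase i,
      (1 - (a + 1) * E) / (1 - a * E) * ‖x i - x j‖ ≤ ‖PhiE f x i - x j‖ := fun j hj => by
    have hji := ne_of_mem_erase hj
    have h1 := norm_sub_norm_le (x i - x j) (x i - PhiE f x i)
    rw [sub_sub_sub_cancel_left, norm_sub_rev (x i) (PhiE f x i)] at h1
    have h2 : u i / (1 - a * E) * ‖x i - x j‖ ≤ E / (1 - a * E) * ‖x i - x j‖ := by
      gcongr; exact huE i
    have h3 : (1 - (a + 1) * E) / (1 - a * E) = 1 - E / (1 - a * E) := by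
      field_simp; ring
    rw [h3]
    linarith [hstep' hji]
  have hsep' : ∀ j ∈ univ.erase i,
      (1 - (a + b) * E) / (1 - a * E) * ‖x i - x j‖ ≤ ‖PhiE f x i - PhiE f x j‖ :=
    fun j hj => by
    have hji := ne_of_mem_erase hj
    have h1 := norm_sub_norm_le (x i - x j) ((x i - PhiE f x i) - (x j - PhiE f x j))
    have h0 : x i - x j - ((x i - PhiE f x i) - (x j - PhiE f x j)) =
      PhiE f x i - PhiE f x j := by ring
    have h2 := norm_sub_le (x i - PhiE f x i) (x j - PhiE f x j)
    rw [norm_sub_rev (x i) (PhiE f x i), norm_sub_rev (x j) (PhiE f x j)] at h2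
    rw [h0] at h1
    have h4 : (u i + u j) / (1 - a * E) * ‖x i - x j‖ ≤
        b * E / (1 - a * E) * ‖x i - x j‖ := by
      gcongr; exact hpairE i j hji.symm
    have h3 : (1 - (a + b) * E) / (1 - a * E) = 1 - b * E / (1 - a * E) := by
      field_simp; ring
    have h5 := hstep' hji
    have h6 := hstep' hji.symm
    rw [norm_sub_rev (x j) (x i)] at h6
    rw [add_div, add_mul] at h4
    rw [h3]
    linarith
  by_cases hW : Wc f x i = 0
  · have hfi : PhiE f x i = x i := by simp [PhiE, hW]
    have hlc : f.leadingCoeff ≠ 0 := leadingCoeff_ne_zero.2 (by rintro rfl; simp at hdeg)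
    have hprod : ∏ j ∈ univ.erase i, (x i - x j) ≠ 0 :=
      prod_ne_zero_iff.2 fun j hj => sub_ne_zero.2 (hx.ne (ne_of_mem_erase hj).symm)
    have hroot : eval (x i) f = 0 := by
      rw [Wc, div_eq_zero_iff] at hW
      exact hW.resolve_right (mul_ne_zero hlc hprod)
    have : Wc f (PhiE f x) i = 0 := by rw [Wc, hfi, hroot, zero_div]
    rw [this, hW]; simp
  have hc1 : 0 < (1 - (a + 1) * E) / (1 - a * E) := div_pos hB hA
  have hc2 : 0 < (1 - (a + b) * E) / (1 - a * E) := div_pos hD hA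
  have hpos1 : ∀ j ∈ univ.erase i, 0 < ‖PhiE f x i - x j‖ := fun j hj =>
    (mul_pos hc1 (hx0 (ne_of_mem_erase hj))).trans_le (hsep j hj)
  have hpos2 : ∀ j ∈ univ.erase i, 0 < ‖PhiE f x i - PhiE f x j‖ := fun j hj =>
    (mul_pos hc2 (hx0 (ne_of_mem_erase hj))).trans_le (hsep' j hj)
  rw [Wc_PhiE_eq hdeg hx (norm_pos_iff.1 (hA.trans_le (hσ i))) hW
    fun j hj => sub_ne_zero.1 (norm_pos_iff.1 (hpos1 j (by simp [hj]))), norm_mul, norm_mul]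
  have hsum : ‖∑ j ∈ univ.erase i,
      Wc f x j * (x i - PhiE f x i) / ((PhiE f x i - x j) * (x i - x j))‖ ≤
      E / (1 - (a + 1) * E) * (a * E) := by
    refine (norm_sum_le _ _).trans ?_
    refine le_trans (sum_le_sum fun j hj => ?_)
      ((mul_sum _ _ _).symm.trans_le (mul_le_mul_of_nonneg_left (hsumE i) (by positivity)))
    have hji := ne_of_mem_erase hj
    rw [norm_div, norm_mul, norm_mul, div_le_iff₀ (mul_pos (hpos1 j hj) (hx0 hji)),
      norm_sub_rev (x i) (PhiE f x i)]
    have h1 : ‖PhiE f x i - x i‖ ≤ E / (1 - a * E) * ‖x i - x j‖ :=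
      (hstep' hji).trans (by gcongr; exact huE i)
    calc ‖Wc f x j‖ * ‖PhiE f x i - x i‖
        ≤ (u j * ‖x i - x j‖) * (E / (1 - a * E) * ‖x i - x j‖) :=
          mul_le_mul (hWu' hji) h1 (norm_nonneg _) (mul_nonneg (hu0 j) (norm_nonneg _))
      _ = E / (1 - (a + 1) * E) * u j *
          ((1 - (a + 1) * E) / (1 - a * E) * ‖x i - x j‖ * ‖x i - x j‖) := by
          have : 1 - E * (a + 1) ≠ 0 := by rw [mul_comm]; exact hB.ne'
          field_simp
      _ ≤ _ := mul_le_mul_of_nonneg_left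
          (mul_le_mul_of_nonneg_right (hsep j hj) (norm_nonneg _))
          (mul_nonneg (by positivity) (hu0 j))
  have hprod : ‖∏ j ∈ univ.erase i, ((PhiE f x i - x j) / (PhiE f x i - PhiE f x j))‖ ≤
      (1 + a * E / (((n : ℝ) - 1) * (1 - (a + b) * E))) ^ (n - 1) := by
    have hT : ∑ j ∈ univ.erase i, u j / (1 - (a + b) * E) ≤ a * E / (1 - (a + b) * E) := by
      rw [← sum_div]
      exact div_le_div_of_nonneg_right (hsumE i) hD.le
    have hne : (univ.erase i).Nonempty := by
      rw [← card_pos, hcard]; omega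
    have h1 := prod_one_add_le_one_add_div_pow _ hne _
      (fun j _ => div_nonneg (hu0 j) hD.le) hT
    rw [hcard, hcast, div_div, mul_comm (1 - (a + b) * E)] at h1
    refine le_trans ?_ h1
    rw [norm_prod]
    refine prod_le_prod (fun _ _ => norm_nonneg _) fun j hj => ?_
    have hji := ne_of_mem_erase hj
    rw [norm_div, div_le_iff₀ (hpos2 j hj)]
    have h2 := norm_add_le (PhiE f x i - PhiE f x j) (PhiE f x j - x j)
    rw [sub_add_sub_cancel] at h2
    have h3 := hstep' hji.symm
    rw [norm_sub_rev (x j) (x i)] at h3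
    have h4 : u j / (1 - a * E) * ‖x i - x j‖ = u j / (1 - (a + b) * E) *
        ((1 - (a + b) * E) / (1 - a * E) * ‖x i - x j‖) := by
      have : 1 - E * (a + b) ≠ 0 := by rw [mul_comm]; exact hD.ne'
      field_simp
    have h5 := mul_le_mul_of_nonneg_left (hsep' j hj) (div_nonneg (hu0 j) hD.le)
    linarith
  have hR : 0 ≤ E / (1 - (a + 1) * E) * (a * E) := by positivity
  calc _ ≤ ‖Wc f x i‖ / (1 - a * E) * (E / (1 - (a + 1) * E) * (a * E)) *
        (1 + a * E / (((n : ℝ) - 1) * (1 - (a + b) * E))) ^ (n - 1) := by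
        refine mul_le_mul (mul_le_mul (hstep i) hsum (norm_nonneg _) ?_) hprod (norm_nonneg _) ?_
        · positivity
        · positivity
    _ = _ := by
        rw [hβ]
        field_simp
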